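/- Let n be an even positive integer and k ≥ 1 an integer. Let cOpt, cOpt' : ZMod n → Bool be colorings with d_H(cOpt, cOpt') = 1 and |CE(cOpt')| = |CE(cOpt)| − 2 (OPT recolors a single node and thereby removes two adjacent cut-edges). Let cOff : ZMod n → Bool satisfy CE(cOff) ⊆ CE(cOpt) and |CE(cOff)| = min(2k, |CE(cOpt)|). Then there exists a coloring cOff' : ZMod n → Bool such that CE(cOff') ⊆ CE(cOpt'), |CE(cOff')| = min(2k, |CE(cOpt')|), and d_H(cOff, cOff') + φ(cOpt', cOff') ≤ 1 + φ(cOpt, cOff). -/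

import Mathlib

/-- The cut-edge set of a coloring `c` of the ring `ZMod n`. -/
def CE {n : ℕ} (c : ZMod n → Bool) : Set (ZMod n) := {i | c i ≠ c (i + 1)}

/-- Hamming distance between two colorings of `ZMod n`. -/
noncomputable def hamDist {n : ℕ} (c c' : ZMod n → Bool) : ℕ :=
  {i : ZMod n | c i ≠ c' i}.ncard

/-- The potential: distance from the coloring of OPT to the nearer of the two
colorings of OFF (up to a swap of color names). -/
noncomputable def pot (n : ℕ) (c c' : ZMod n → Bool) : ℕ :=
  min (hamDist c c') (n - hamDist c c')

/-- The cut-edges of a coloring of a ring are even in number. -/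
theorem even_ncard_CE {n : ℕ} [NeZero n] (c : ZMod n → Bool) : Even (CE c).ncard := by
  classical
  let b : ZMod n → ZMod 2 := fun i => if c i then 1 else 0
  have hshift : ∑ i, b (i + 1) = ∑ i, b i := Equiv.sum_comp (Equiv.addRight 1) b
  have hsum : ∑ i, (b i + b (i + 1)) = 0 := by
    rw [Finset.sum_add_distrib, hshift]
    exact CharTwo.add_self_eq_zero _
  have hterm : ∀ i, b i + b (i + 1) = if c i ≠ c (i + 1) then 1 else 0 := by
    intro i
    simp only [b]
    cases c i <;> cases c (i + 1) <;> decide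
  simp_rw [hterm] at hsum
  rw [Finset.sum_boole, ZMod.natCast_eq_zero_iff_even] at hsum
  have hset : CE c = ↑(Finset.univ.filter fun i => c i ≠ c (i + 1)) := by
    ext i
    simp [CE]
  rwa [hset, Set.ncard_coe_finset]

/-- In a ring, the arc of a proper subset `D` through a point `x ∈ D` is bounded by two
edges, and its neighbouring nodes are outside `D`. -/
theorem exists_arc {n : ℕ} [NeZero n] (D : Set (ZMod n)) {x y : ZMod n} (hx : x ∈ D)
    (hy : y ∉ D) :
    ∃ (A : Set (ZMod n)) (p q : ZMod n), A ⊆ D ∧ x ∈ A ∧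
      p ∉ D ∧ p + 1 ∈ A ∧ q ∈ A ∧ q + 1 ∉ D ∧
      ∀ i, i ≠ p → i ≠ q → (i ∈ A ↔ i + 1 ∈ A) := by
  classical
  have hr : ∃ r : ℕ, x + r ∉ D := ⟨(y - x).val, by simpa using hy⟩
  have hl : ∃ l : ℕ, x - l ∉ D := ⟨(x - y).val, by simpa using hy⟩
  obtain ⟨r, hr, hrmin⟩ : ∃ r : ℕ, x + r ∉ D ∧ ∀ m < r, x + m ∈ D :=
    ⟨Nat.find hr, Nat.find_spec hr, fun m hm => not_not.1 (Nat.find_min hr hm)⟩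
  obtain ⟨l, hl, hlmin⟩ : ∃ l : ℕ, x - l ∉ D ∧ ∀ m < l, x - m ∈ D :=
    ⟨Nat.find hl, Nat.find_spec hl, fun m hm => not_not.1 (Nat.find_min hl hm)⟩
  obtain _ | r := r
  · simp [hx] at hr
  obtain _ | l := l
  · simp [hx] at hl
  push_cast at hr hl
  have hAD : ∀ j ≤ l + r, x - l + (j : ZMod n) ∈ D := by
    intro j hj
    rcases le_total j l with h | h
    · have := hlmin (l - j) (by omega)
      rw [Nat.cast_sub h] at this
      convert this using 1
      ring
    · have := hrmin (j - l) (by omega)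
      rw [Nat.cast_sub h] at this
      convert this using 1
      ring
  have hp : x - l - 1 ∉ D := by rwa [sub_sub]
  refine ⟨{z | ∃ j ≤ l + r, z = x - l + (j : ZMod n)}, x - l - 1, x + r, ?_, ?_, hp, ?_, ?_, ?_, ?_⟩
  · rintro z ⟨j, hj, rfl⟩
    exact hAD j hj
  · exact ⟨l, by omega, by ring⟩
  · exact ⟨0, by omega, by push_cast; ring⟩
  · exact ⟨l + r, le_rfl, by push_cast; ring⟩
  · simpa only [Set.mem_ofPred_eq, add_assoc] using hr
  · intro i hip hiq
    constructor
    · rintro ⟨j, hj, rfl⟩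
      have : j ≠ l + r := by
        rintro rfl
        exact hiq (by push_cast; ring)
      exact ⟨j + 1, by omega, by push_cast; ring⟩
    · rintro ⟨j, hj, h⟩
      obtain _ | j := j
      · exact absurd (by rw [eq_sub_iff_add_eq, h]; simp) hip
      · exact ⟨j, by omega, by
          rw [← add_left_inj (1 : ZMod n), h]; push_cast; ring⟩

/-- Recoloring `f` to agree with `g` on an arc where the two differ exchanges `CE f` for `CE g`
at the two ends of the arc and keeps it elsewhere. -/
theorem exists_flip_arc {n : ℕ} [NeZero n] (f g : ZMod n → Bool) {x y : ZMod n}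
    (hx : f x ≠ g x) (hy : f y = g y) :
    ∃ (f₁ : ZMod n → Bool) (p q : ZMod n), f₁ x = g x ∧ (∀ i, f₁ i = f i ∨ f₁ i = g i) ∧
      (p ∈ CE f₁ ↔ p ∈ CE g) ∧ (q ∈ CE f₁ ↔ q ∈ CE g) ∧
      (∀ i, i ≠ p → i ≠ q → (i ∈ CE f₁ ↔ i ∈ CE f)) ∧
      (∀ i, f i = g i → f (i + 1) ≠ g (i + 1) → i + 1 = x → i = p ∨ i = q) ∧
      (∀ i, f i ≠ g i → f (i + 1) = g (i + 1) → i = x → i = p ∨ i = q) := by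
  classical
  obtain ⟨A, p, q, hAD, hxA, hp, hp1, hq, hq1, hA⟩ :=
    exists_arc {i | f i ≠ g i} (y := y) hx (by simpa using hy)
  have hpA : p ∉ A := fun h => hp (hAD h)
  have hqA : q + 1 ∉ A := fun h => hq1 (hAD h)
  simp only [Set.mem_ofPred_eq, not_not, ne_eq] at hp hq1
  refine ⟨fun i => if i ∈ A then g i else f i, p, q, by simp [hxA], ?_, ?_, ?_, ?_, ?_, ?_⟩
  · intro i
    by_cases h : i ∈ A <;> simp [h]
  · simp [CE, hpA, hp1, hp]
  · simp [CE, hq, hqA, hq1]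
  · intro i hip hiq
    have h := hA i hip hiq
    by_cases hi : i ∈ A
    · have hi1 := h.1 hi
      have h0 := hAD hi
      have h1 := hAD hi1
      simp only [Set.mem_ofPred_eq] at h0 h1
      simp only [CE, Set.mem_ofPred_eq, hi, hi1, if_true]
      revert h0 h1
      cases f i <;> cases g i <;> cases f (i + 1) <;> cases g (i + 1) <;> simp
    · have hi1 : i + 1 ∉ A := fun h' => hi (h.2 h')
      simp [CE, hi, hi1]
  · intro i h0 _ hix
    by_contra! hne
    exact hAD ((hA i hne.1 hne.2).2 (hix ▸ hxA)) h0
  · intro i _ h1 hix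
    by_contra! hne
    exact hAD ((hA i hne.1 hne.2).1 (hix ▸ hxA)) h1

/-- An edge that is cut by exactly one of two colorings is an end of an arc where they differ;
recoloring that arc brings the first coloring closer to the second. -/
theorem exists_flip_edge {n : ℕ} [NeZero n] (f g : ZMod n → Bool) {e : ZMod n}
    (he : e ∈ CE f ↔ e ∉ CE g) :
    ∃ (f₁ : ZMod n → Bool) (q : ZMod n), hamDist f₁ g < hamDist f g ∧
      (∀ i, f₁ i = f i ∨ f₁ i = g i) ∧ (e ∈ CE f₁ ↔ e ∈ CE g) ∧
      (∀ i, i ≠ e → i ≠ q → (i ∈ CE f₁ ↔ i ∈ CE f)) := by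
  have hlt : ∀ (f₁ : ZMod n → Bool) (x : ZMod n), f x ≠ g x → f₁ x = g x →
      (∀ i, f₁ i = f i ∨ f₁ i = g i) → hamDist f₁ g < hamDist f g := by
    intro f₁ x hx hx₁ hbet
    refine Set.ncard_lt_ncard ⟨fun i hi => ?_, fun h => h hx hx₁⟩ (Set.toFinite _)
    rcases hbet i with h | h
    · exact fun h' => hi (h.trans h')
    · exact absurd h hi
  have hend : (f e = g e ∧ f (e + 1) ≠ g (e + 1)) ∨ (f e ≠ g e ∧ f (e + 1) = g (e + 1)) := by
    simp only [CE, Set.mem_ofPred_eq] at he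
    revert he
    cases f e <;> cases g e <;> cases f (e + 1) <;> cases g (e + 1) <;> simp
  rcases hend with ⟨h0, h1⟩ | ⟨h0, h1⟩
  · obtain ⟨f₁, p, q, hx, hbet, hp₁, hq₁, hoff, hr, -⟩ := exists_flip_arc f g h1 h0
    rcases hr e h0 h1 rfl with rfl | rfl
    · exact ⟨f₁, q, hlt f₁ _ h1 hx hbet, hbet, hp₁, hoff⟩
    · exact ⟨f₁, p, hlt f₁ _ h1 hx hbet, hbet, hq₁, fun i h h' => hoff i h' h⟩
  · obtain ⟨f₁, p, q, hx, hbet, hp₁, hq₁, hoff, -, hr⟩ := exists_flip_arc f g h0 h1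
    rcases hr e h0 h1 rfl with rfl | rfl
    · exact ⟨f₁, q, hlt f₁ _ h0 hx hbet, hbet, hp₁, hoff⟩
    · exact ⟨f₁, p, hlt f₁ _ h0 hx hbet, hbet, hq₁, fun i h h' => hoff i h' h⟩

/-- Between two colorings `f` and `g` there are colorings whose cut-edges are among those of `g`,
with any prescribed even number of cut-edges from `|CE f|` to `|CE g|`. -/
theorem exists_between_coloring {n : ℕ} [NeZero n] (g : ZMod n → Bool) {t : ℕ} (ht : Even t)
    (htg : t ≤ (CE g).ncard) (f : ZMod n → Bool) (hft : (CE f).ncard ≤ t) :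
    ∃ h : ZMod n → Bool, (∀ i, h i = f i ∨ h i = g i) ∧ CE h ⊆ CE g ∧ (CE h).ncard = t := by
  induction hd : hamDist f g using Nat.strong_induction_on generalizing f with
  | _ d ih =>
  have step : ∀ f₁ : ZMod n → Bool, hamDist f₁ g < hamDist f g →
      (∀ i, f₁ i = f i ∨ f₁ i = g i) → (CE f₁).ncard ≤ t →
      ∃ h : ZMod n → Bool, (∀ i, h i = f i ∨ h i = g i) ∧ CE h ⊆ CE g ∧ (CE h).ncard = t := by
    intro f₁ hlt hbet hcard
    obtain ⟨h, hh, hsub, hcard⟩ := ih _ (hd ▸ hlt) f₁ hcard rfl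
    refine ⟨h, fun i => ?_, hsub, hcard⟩
    rcases hh i with h' | h'
    · rw [h']
      exact hbet i
    · exact Or.inr h'
  by_cases hsub : CE f ⊆ CE g
  · rcases hft.eq_or_lt with heq | hlt
    · exact ⟨f, fun i => Or.inl rfl, hsub, heq⟩
    · obtain ⟨e, heg, hef⟩ := Set.exists_mem_notMem_of_ncard_lt_ncard (hlt.trans_le htg)
      obtain ⟨f₁, q, hlt₁, hbet, -, hoff⟩ :=
        exists_flip_edge f g (e := e) (by tauto)
      refine step f₁ hlt₁ hbet ?_
      have hins : CE f₁ ⊆ insert e (insert q (CE f)) := by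
        intro i hi
        by_cases h : i = e
        · exact Or.inl h
        by_cases h' : i = q
        · exact Or.inr (Or.inl h')
        exact Or.inr (Or.inr ((hoff i h h').1 hi))
      have h1 := Set.ncard_le_ncard hins (Set.toFinite _)
      have h2 := Set.ncard_insert_le e (insert q (CE f))
      have h3 := Set.ncard_insert_le q (CE f)
      obtain ⟨a, ha⟩ := even_ncard_CE f
      obtain ⟨b, hb⟩ := ht
      omega
  · obtain ⟨e, hef, heg⟩ := Set.not_subset.1 hsub
    obtain ⟨f₁, q, hlt₁, hbet, he₁, hoff⟩ :=
      exists_flip_edge f g (e := e) (by tauto)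
    refine step f₁ hlt₁ hbet ?_
    have hins : CE f₁ ⊆ insert q (CE f \ {e}) := by
      intro i hi
      by_cases h : i = e
      · subst h
        exact absurd (he₁.1 hi) heg
      by_cases h' : i = q
      · exact Or.inl h'
      exact Or.inr ⟨(hoff i h h').1 hi, h⟩
    have h1 := Set.ncard_le_ncard hins (Set.toFinite _)
    have h2 := Set.ncard_insert_le q (CE f \ {e})
    have h3 := Set.ncard_sdiff_singleton_add_one hef (Set.toFinite _)
    omega

theorem hamDist_triangle {n : ℕ} [NeZero n] (a b c : ZMod n → Bool) :
    hamDist a c ≤ hamDist a b + hamDist b c := by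
  refine (Set.ncard_le_ncard (fun i hi => ?_) (Set.toFinite _)).trans
    (Set.ncard_union_le {i | a i ≠ b i} {i | b i ≠ c i})
  by_contra hcon
  simp only [Set.mem_union, Set.mem_ofPred_eq, not_or, not_not] at hcon
  exact hi (hcon.1.trans hcon.2)

theorem hamDist_comm {n : ℕ} (a b : ZMod n → Bool) : hamDist a b = hamDist b a := by
  simp only [hamDist, ne_comm]

theorem hamDist_add_of_between {n : ℕ} [NeZero n] {f g h : ZMod n → Bool}
    (hbet : ∀ i, h i = f i ∨ h i = g i) : hamDist f h + hamDist g h = hamDist g f := by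
  unfold hamDist
  rw [← Set.ncard_union_eq _ (Set.toFinite _) (Set.toFinite _)]
  · congr 1
    ext i
    simp only [Set.mem_union, Set.mem_ofPred_eq]
    rcases hbet i with h' | h' <;> rw [h'] <;> simp [eq_comm]
  · rw [Set.disjoint_left]
    intro i h1 h2
    rcases hbet i with h' | h'
    · exact h1 h'.symm
    · exact h2 h'.symm

theorem hamDist_not_left {n : ℕ} [NeZero n] (a b : ZMod n → Bool) :
    hamDist (fun i => !a i) b = n - hamDist a b := by
  have hcompl : {i : ZMod n | (!a i) ≠ b i} = {i | a i ≠ b i}ᶜ := by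
    ext i
    simp only [Set.mem_compl_iff, Set.mem_ofPred_eq]
    cases a i <;> cases b i <;> simp
  have hadd := Set.ncard_add_ncard_compl {i : ZMod n | a i ≠ b i}
  rw [Nat.card_zmod] at hadd
  unfold hamDist
  rw [hcompl]
  omega

theorem CE_not {n : ℕ} (c : ZMod n → Bool) : CE (fun i => !c i) = CE c := by
  ext i
  simp [CE]

/-- On a shortest way from `f` to `g` there is a coloring whose cut-edges are among those of `g`
and number `min |CE f| |CE g|`. -/
theorem exists_response {n : ℕ} [NeZero n] {m : ℕ} (f g : ZMod n → Bool)
    (hm : m = min (CE f).ncard (CE g).ncard) :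
    ∃ h : ZMod n → Bool, CE h ⊆ CE g ∧ (CE h).ncard = m ∧
      hamDist f h + hamDist g h = hamDist g f := by
  rcases le_total (CE f).ncard (CE g).ncard with hle | hle
  · obtain ⟨h, hbet, hsub, hcard⟩ := exists_between_coloring g (even_ncard_CE f) hle f le_rfl
    exact ⟨h, hsub, by omega, hamDist_add_of_between hbet⟩
  · exact ⟨g, subset_rfl, by omega, hamDist_add_of_between fun i => Or.inr rfl⟩

theorem off_response_remove (n k : ℕ) (hn : 0 < n) (hne : Even n) (hk : 1 ≤ k)
    (cOpt cOpt' cOff : ZMod n → Bool)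
    (hstep : hamDist cOpt cOpt' = 1)
    (hrem : (CE cOpt').ncard + 2 = (CE cOpt).ncard)
    (hsub : CE cOff ⊆ CE cOpt)
    (hcard : (CE cOff).ncard = min (2 * k) (CE cOpt).ncard) :
    ∃ cOff' : ZMod n → Bool,
      CE cOff' ⊆ CE cOpt' ∧
      (CE cOff').ncard = min (2 * k) (CE cOpt').ncard ∧
      hamDist cOff cOff' + pot n cOpt' cOff' ≤ 1 + pot n cOpt cOff := by
  have : NeZero n := ⟨hn.ne'⟩
  have hmin : min (2 * k) (CE cOpt').ncard = min (CE cOff).ncard (CE cOpt').ncard := by omega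
  rw [hmin]
  have hmin_pot : pot n cOpt cOff = hamDist cOpt cOff ∨
      pot n cOpt cOff = n - hamDist cOpt cOff := min_choice _ _
  rcases hmin_pot with hpot | hpot
  · obtain ⟨h, hsub', hcard', hdist⟩ := exists_response cOff cOpt' rfl
    refine ⟨h, hsub', hcard', ?_⟩
    have htri := hamDist_triangle cOpt' cOpt cOff
    rw [hamDist_comm cOpt' cOpt] at htri
    have hle : pot n cOpt' h ≤ hamDist cOpt' h := min_le_left _ _
    omega
  · obtain ⟨h, hsub', hcard', hdist⟩ := exists_response cOff (fun i => !cOpt' i) rfl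
    rw [CE_not] at hsub' hcard'
    refine ⟨h, hsub', hcard', ?_⟩
    rw [hamDist_not_left, hamDist_not_left] at hdist
    have htri := hamDist_triangle cOpt cOpt' cOff
    have hle : pot n cOpt' h ≤ n - hamDist cOpt' h := min_le_right _ _
    omega
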